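/- Let N ≥ 1 and let X be an extension of the symplectic character ratio of size N. Then X(1, …, 1) = 3^{ν_N} · γ_N, where ν_N = n(n−1) if N = 2n and ν_N = n² if N = 2n+1. -/

import Mathlib

noncomputable section

/-- `δ_i = N − i + 1` for the 1-based index `i`; here `i : Fin N` is 0-based. -/
def deltaE (N : ℕ) (i : Fin N) : ℕ := N - i.1

/-- `μ_i = λ_i + δ_i` with `λ_i = ⌊(N−i)/2⌋` for the 1-based index `i`. -/
def muE (N : ℕ) (i : Fin N) : ℕ := (N - i.1 - 1) / 2 + (N - i.1)

/-- The determinant `det_{i,j} (z_j^{e_i} − z_j^{−e_i})`. -/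
def sdet (N : ℕ) (e : Fin N → ℕ) (z : Fin N → ℂ) : ℂ :=
  Matrix.det (Matrix.of fun i j : Fin N => z j ^ (e i : ℤ) - z j ^ (-(e i : ℤ)))

/-- `X` is a (continuous) extension of the symplectic character ratio of size `N`:
it agrees with `det(z_j^{μ_i} − z_j^{−μ_i}) / det(z_j^{δ_i} − z_j^{−δ_i})`
whenever the denominator is nonzero. -/
def IsSymplecticExt (N : ℕ) (X : (Fin N → ℂ) → ℂ) : Prop :=
  ContinuousOn X {z : Fin N → ℂ | ∀ i, z i ≠ 0} ∧
  ∀ z : Fin N → ℂ, (∀ i, z i ≠ 0) → sdet N (deltaE N) z ≠ 0 →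
    X z = sdet N (muE N) z / sdet N (deltaE N) z

/-- Binomial coefficient `C(a,b)` for integers, vanishing unless `0 ≤ b ≤ a`. -/
def zchoose (a b : ℤ) : ℤ := if 0 ≤ b ∧ b ≤ a then (a.toNat).choose b.toNat else 0

/-- `γ_N`: `A_V(N+1)` for `N` even, `N_8(N+1)` for `N` odd. -/
def gammaN (N : ℕ) : ℝ :=
  if N % 2 = 0 then
    ((2:ℝ)⁻¹) ^ (N/2) * ∏ i ∈ Finset.Icc 1 (N/2),
      ((Nat.factorial (6*i-2) : ℝ) * (Nat.factorial (2*i-1) : ℝ)) /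
        ((Nat.factorial (4*i-2) : ℝ) * (Nat.factorial (4*i-1) : ℝ))
  else
    ∏ i ∈ Finset.range ((N+1)/2),
      (((3*i+1 : ℕ) : ℝ) * (Nat.factorial (6*i) : ℝ) * (Nat.factorial (2*i) : ℝ)) /
        ((Nat.factorial (4*i) : ℝ) * (Nat.factorial (4*i+1) : ℝ))

/-- `ν_N = n(n−1)` if `N = 2n` and `ν_N = n²` if `N = 2n+1`. -/
def nuN (N : ℕ) : ℕ := if N % 2 = 0 then (N/2) * (N/2 - 1) else (N/2)^2

open Finset Filter Topology

lemma chebyshev_S_monic_natDegree (n : ℕ) :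
    (Polynomial.Chebyshev.S ℝ n).Monic ∧ (Polynomial.Chebyshev.S ℝ n).natDegree = n := by
  induction n using Nat.twoStepInduction with
  | zero => simp
  | one => simp [Polynomial.monic_X]
  | more n ih₀ ih₁ =>
    have hmon : (Polynomial.X * Polynomial.Chebyshev.S ℝ (n + 1 : ℕ)).Monic :=
      Polynomial.monic_X.mul ih₁.1
    have hnat : (Polynomial.X * Polynomial.Chebyshev.S ℝ (n + 1 : ℕ)).natDegree = n + 2 := by
      rw [Polynomial.monic_X.natDegree_mul ih₁.1, ih₁.2, Polynomial.natDegree_X]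
      ring
    have hdeg : (Polynomial.Chebyshev.S ℝ n).degree <
        (Polynomial.X * Polynomial.Chebyshev.S ℝ (n + 1 : ℕ)).degree := by
      rw [Polynomial.degree_eq_natDegree ih₀.1.ne_zero, Polynomial.degree_eq_natDegree hmon.ne_zero,
        ih₀.2, hnat]
      exact_mod_cast (by omega : n < n + 2)
    have hrec : Polynomial.Chebyshev.S ℝ (n + 2 : ℕ) =
        Polynomial.X * Polynomial.Chebyshev.S ℝ (n + 1 : ℕ) - Polynomial.Chebyshev.S ℝ n := by
      push_cast
      exact Polynomial.Chebyshev.S_add_two ℝ n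
    rw [hrec]
    exact ⟨hmon.sub_of_left hdeg,
      by rw [Polynomial.natDegree_sub_eq_left_of_natDegree_lt (by omega), hnat]⟩

/-- The Weyl denominator formula of type `C` in hyperbolic form. -/
lemma det_two_mul_sinh (N : ℕ) (θ : Fin N → ℝ) :
    (Matrix.of fun i j : Fin N => 2 * Real.sinh ((j + 1) * θ i)).det =
      (∏ i, 2 * Real.sinh (θ i)) *
        ∏ i, ∏ j ∈ Ioi i, (2 * Real.cosh (θ j) - 2 * Real.cosh (θ i)) := by
  rw [← Matrix.det_vandermonde fun i => 2 * Real.cosh (θ i),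
    Matrix.det_eval_matrixOfPolynomials_eq_det_vandermonde _
      (fun j : Fin N => Polynomial.Chebyshev.S ℝ (j : ℕ))
      (fun j => (chebyshev_S_monic_natDegree j).2) fun j => (chebyshev_S_monic_natDegree j).1,
    ← Matrix.det_mul_column]
  congr 1
  ext i j
  have h := Polynomial.Chebyshev.S_two_mul_real_cosh (θ i) (j : ℕ)
  simp only [Matrix.of_apply]
  push_cast at h ⊢
  rw [← h]
  ring

lemma sdet_exp (N : ℕ) (e : Fin N → ℕ) (t : ℝ) :
    sdet N e (fun j => Complex.exp (t * (j + 1))) =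
      (((∏ i, 2 * Real.sinh (t * e i)) *
        ∏ i, ∏ j ∈ Ioi i, (2 * Real.cosh (t * e j) - 2 * Real.cosh (t * e i)) : ℝ) : ℂ) := by
  rw [← det_two_mul_sinh, sdet, ← Complex.ofRealHom_eq_coe (Matrix.det _), RingHom.map_det]
  congr 1
  ext i j
  simp only [Matrix.of_apply, RingHom.mapMatrix_apply, Matrix.map_apply, Complex.ofRealHom_eq_coe]
  push_cast
  rw [Complex.two_sinh, ← Complex.exp_int_mul, ← Complex.exp_int_mul]
  push_cast
  ring_nf

lemma cosh_sub_cosh_eq (a b : ℝ) :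
    Real.cosh a - Real.cosh b = 2 * (Real.sinh ((a + b) / 2) * Real.sinh ((a - b) / 2)) := by
  have h₁ := Real.cosh_add ((a + b) / 2) ((a - b) / 2)
  have h₂ := Real.cosh_sub ((a + b) / 2) ((a - b) / 2)
  rw [show (a + b) / 2 + (a - b) / 2 = a by ring] at h₁
  rw [show (a + b) / 2 - (a - b) / 2 = b by ring] at h₂
  linarith

lemma tendsto_sinh_mul_div (a b : ℝ) (hb : b ≠ 0) :
    Tendsto (fun t : ℝ => Real.sinh (t * a) / Real.sinh (t * b)) (𝓝[>] 0) (𝓝 (a / b)) := by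
  have key (c : ℝ) : Tendsto (fun t : ℝ => Real.sinh (t * c) / t) (𝓝[>] 0) (𝓝 c) := by
    have h : HasDerivAt (fun t : ℝ => Real.sinh (t * c)) c 0 := by
      simpa using ((hasDerivAt_id (0 : ℝ)).mul_const c).sinh
    have h' := h.tendsto_slope_zero_right
    simpa [div_eq_inv_mul] using h'
  refine ((key a).div (key b) hb).congr' ?_
  filter_upwards [self_mem_nhdsWithin] with t ht
  exact div_div_div_cancel_right₀ (ne_of_gt ht) _ _

lemma tendsto_cosh_sub_cosh_div (a b c d : ℝ) (h₁ : c + d ≠ 0) (h₂ : c - d ≠ 0) :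
    Tendsto (fun t : ℝ => (2 * Real.cosh (t * a) - 2 * Real.cosh (t * b)) /
      (2 * Real.cosh (t * c) - 2 * Real.cosh (t * d))) (𝓝[>] 0)
      (𝓝 ((a ^ 2 - b ^ 2) / (c ^ 2 - d ^ 2))) := by
  have h := (tendsto_sinh_mul_div ((a + b) / 2) ((c + d) / 2) (by simpa using h₁)).mul
    (tendsto_sinh_mul_div ((a - b) / 2) ((c - d) / 2) (by simpa using h₂))
  convert h using 2
  · rw [← mul_sub, ← mul_sub, cosh_sub_cosh_eq, cosh_sub_cosh_eq, mul_div_mul_left _ _ two_ne_zero,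
      mul_div_mul_left _ _ two_ne_zero, div_mul_div_comm]
    ring_nf
  · rw [div_div_div_cancel_right₀ two_ne_zero, div_div_div_cancel_right₀ two_ne_zero,
      div_mul_div_comm, sq_sub_sq, sq_sub_sq]

/-- The value of the symplectic character at the identity, as given by Weyl's dimension formula. -/
def symplDim (N : ℕ) : ℝ :=
  (∏ i, (muE N i : ℝ) / deltaE N i) *
    ∏ i, ∏ j ∈ Ioi i,
      ((muE N j : ℝ) ^ 2 - (muE N i : ℝ) ^ 2) / ((deltaE N j : ℝ) ^ 2 - (deltaE N i : ℝ) ^ 2)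

lemma deltaE_pos (N : ℕ) (i : Fin N) : (0 : ℝ) < deltaE N i := by
  have : 0 < deltaE N i := by simp only [deltaE]; omega
  exact_mod_cast this

lemma deltaE_lt {N : ℕ} {i j : Fin N} (h : i < j) : (deltaE N j : ℝ) < deltaE N i := by
  have : deltaE N j < deltaE N i := by simp only [deltaE]; omega
  exact_mod_cast this

lemma sdet_deltaE_exp_ne_zero (N : ℕ) {t : ℝ} (ht : 0 < t) :
    sdet N (deltaE N) (fun j => Complex.exp (t * (j + 1))) ≠ 0 := by
  rw [sdet_exp, Complex.ofReal_ne_zero]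
  refine mul_ne_zero (prod_ne_zero_iff.2 fun i _ => ?_)
    (prod_ne_zero_iff.2 fun i _ => prod_ne_zero_iff.2 fun j hj => ?_)
  · have := Real.sinh_pos_iff.2 (mul_pos ht (deltaE_pos N i))
    positivity
  · have h := mul_lt_mul_of_pos_left (deltaE_lt (mem_Ioi.1 hj)) ht
    have h' := mul_pos ht (deltaE_pos N j)
    have := Real.cosh_lt_cosh (x := t * deltaE N j) (y := t * deltaE N i) |>.2 (by rwa [abs_of_pos h', abs_of_pos (h'.trans h)])
    linarith

lemma IsSymplecticExt.apply_one {N : ℕ} {X : (Fin N → ℂ) → ℂ} (hX : IsSymplecticExt N X) :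
    X (fun _ => 1) = (symplDim N : ℂ) := by
  have hz : Tendsto (fun (t : ℝ) (j : Fin N) => Complex.exp (t * (j + 1))) (𝓝[>] 0)
      (𝓝[{z : Fin N → ℂ | ∀ i, z i ≠ 0}] fun _ => 1) := by
    refine tendsto_nhdsWithin_iff.2 ⟨?_, Eventually.of_forall fun t i => Complex.exp_ne_zero _⟩
    have hc : Continuous fun (t : ℝ) (j : Fin N) => Complex.exp (t * (j + 1)) := by fun_prop
    simpa using hc.continuousAt.tendsto.mono_left (nhdsWithin_le_nhds (a := (0 : ℝ)))
  refine tendsto_nhds_unique ((hX.1 _ fun i => one_ne_zero).tendsto.comp hz) ?_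
  have hlim : Tendsto (fun t : ℝ =>
      (∏ i, 2 * Real.sinh (t * muE N i) / (2 * Real.sinh (t * deltaE N i))) *
        ∏ i, ∏ j ∈ Ioi i, (2 * Real.cosh (t * muE N j) - 2 * Real.cosh (t * muE N i)) /
          (2 * Real.cosh (t * deltaE N j) - 2 * Real.cosh (t * deltaE N i)))
      (𝓝[>] 0) (𝓝 (symplDim N)) := by
    refine Tendsto.mul (tendsto_finsetProd _ fun i _ => ?_)
      (tendsto_finsetProd _ fun i _ => tendsto_finsetProd _ fun j hj => ?_)
    · simp_rw [mul_div_mul_left _ _ (two_ne_zero' ℝ)]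
      exact tendsto_sinh_mul_div _ _ (deltaE_pos N i).ne'
    · exact tendsto_cosh_sub_cosh_div _ _ _ _ (add_pos (deltaE_pos N j) (deltaE_pos N i)).ne'
        (sub_neg.2 (deltaE_lt (mem_Ioi.1 hj))).ne
  refine ((Complex.continuous_ofReal.tendsto _).comp hlim).congr' ?_
  filter_upwards [self_mem_nhdsWithin] with t ht
  simp only [Function.comp_apply]
  rw [hX.2 _ (fun i => Complex.exp_ne_zero _) (sdet_deltaE_exp_ne_zero N ht), sdet_exp, sdet_exp,
    ← Complex.ofReal_div]
  simp only [prod_div_distrib, div_mul_div_comm]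

/-- The `k`-th smallest shifted part of the double staircase. -/
def stair (k : ℕ) : ℕ := k / 2 + (k + 1)

lemma prod_reflect_mul_prod_add {M : Type*} [CommMonoid M] (g : ℕ → M) (n m : ℕ) :
    (∏ l ∈ range n, g (n - 1 - l)) * ∏ l ∈ range m, g (n + l) = ∏ j ∈ range (n + m), g j := by
  rw [prod_range_reflect, prod_range_add]

lemma prod_sq_sub_sq_eq_factorial (N : ℕ) :
    ((N : ℝ) + 1) * ∏ k ∈ range N, (((N : ℝ) + 1) ^ 2 - ((k : ℝ) + 1) ^ 2) =
      (2 * N + 1).factorial := by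
  have h := prod_reflect_mul_prod_add (fun j : ℕ => j + 1) N (N + 1)
  rw [prod_range_add_one_eq_factorial, prod_range_succ', ← mul_assoc, ← prod_mul_distrib,
    mul_comm, add_zero, show N + (N + 1) = 2 * N + 1 by ring] at h
  rw [← h]
  push_cast
  congr 1
  refine prod_congr rfl fun k hk => ?_
  obtain ⟨m, rfl⟩ := Nat.exists_eq_add_of_lt (mem_range.1 hk)
  rw [show k + m + 1 - 1 - k = m by omega]
  push_cast
  ring

lemma symplDim_succ (N : ℕ) :
    symplDim (N + 1) = symplDim N *
      (stair N * ∏ k ∈ range N, ((stair N : ℝ) ^ 2 - (stair k : ℝ) ^ 2)) /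
        (2 * N + 1).factorial := by
  have hmu (i : Fin N) : muE (N + 1) i.succ = muE N i := by simp [muE]
  have hdelta (i : Fin N) : deltaE (N + 1) i.succ = deltaE N i := by simp [deltaE]
  have hmu₀ : muE (N + 1) 0 = stair N := by simp [muE, stair]
  have hdelta₀ : deltaE (N + 1) 0 = N + 1 := by simp [deltaE]
  have hmuN (i : Fin N) : muE N i = stair (N - 1 - i) := by
    simp only [muE, stair]; omega
  have hdeltaN (i : Fin N) : deltaE N i = N - 1 - i + 1 := by
    simp only [deltaE]; omega
  rw [← prod_sq_sub_sq_eq_factorial]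
  have hrow : (∏ j : Fin N, ((muE N j : ℝ) ^ 2 - (stair N : ℝ) ^ 2) /
      ((deltaE N j : ℝ) ^ 2 - ((N + 1 : ℕ) : ℝ) ^ 2)) =
      (∏ k ∈ range N, ((stair N : ℝ) ^ 2 - (stair k : ℝ) ^ 2)) /
        ∏ k ∈ range N, (((N : ℝ) + 1) ^ 2 - ((k : ℝ) + 1) ^ 2) := by
    rw [← prod_div_distrib, ← prod_range_reflect, prod_range]
    refine prod_congr rfl fun j _ => ?_
    rw [hmuN, hdeltaN, ← neg_div_neg_eq]
    push_cast
    ring_nf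
  rw [symplDim, symplDim, Fin.prod_univ_succ, Fin.prod_univ_succ, Fin.prod_Ioi_zero]
  simp only [Fin.prod_Ioi_succ, hmu, hdelta, hmu₀, hdelta₀, hrow]
  push_cast
  simp only [div_eq_mul_inv, mul_inv]
  ac_rfl

lemma prod_range_two_mul {M : Type*} [CommMonoid M] (f : ℕ → M) (n : ℕ) :
    ∏ k ∈ range (2 * n), f k = ∏ l ∈ range n, f (2 * l) * f (2 * l + 1) := by
  induction n with
  | zero => simp
  | succ n ih => rw [mul_add_one, prod_range_succ, prod_range_succ, ih, prod_range_succ, mul_assoc]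

lemma stair_two_mul (l : ℕ) : stair (2 * l) = 3 * l + 1 := by simp only [stair]; omega

lemma stair_two_mul_add_one (l : ℕ) : stair (2 * l + 1) = 3 * l + 2 := by
  simp only [stair]; omega

lemma prod_three_mul_add_one_eq (n : ℕ) :
    ∏ j ∈ range n, (3 * ((j : ℝ) + 1)) = 3 ^ n * n.factorial := by
  rw [prod_mul_distrib, prod_const, card_range, ← prod_range_add_one_eq_factorial]
  push_cast
  rfl

lemma prod_stair_even (n : ℕ) :
    ∏ k ∈ range (2 * n), ((stair (2 * n) : ℝ) ^ 2 - (stair k : ℝ) ^ 2) =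
      3 ^ (2 * n) * (2 * n).factorial * ∏ j ∈ range (2 * n), (3 * (j : ℝ) + 2) := by
  rw [← prod_three_mul_add_one_eq, ← prod_mul_distrib, prod_range_two_mul, two_mul n, ← prod_reflect_mul_prod_add, ← prod_mul_distrib, ← two_mul n]
  refine prod_congr rfl fun l hl => ?_
  obtain ⟨m, rfl⟩ := Nat.exists_eq_add_of_lt (mem_range.1 hl)
  rw [stair_two_mul, stair_two_mul, stair_two_mul_add_one, show l + m + 1 - 1 - l = m by omega]
  push_cast
  ring

lemma prod_stair_odd (n : ℕ) :
    ∏ k ∈ range (2 * n + 1), ((stair (2 * n + 1) : ℝ) ^ 2 - (stair k : ℝ) ^ 2) =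
      3 ^ (2 * n + 1) * (2 * n + 1).factorial * ∏ j ∈ range (2 * n + 1), (3 * (j : ℝ) + 1) := by
  have h := prod_reflect_mul_prod_add
    (fun j : ℕ => 3 * ((j : ℝ) + 1) * (3 * ((j + 1 : ℕ) : ℝ) + 1)) n n
  have hA : ∏ j ∈ range (2 * n + 1), (3 * ((j : ℝ) + 1) * (3 * j + 1)) =
      (3 * (2 * n + 1)) * ∏ j ∈ range (2 * n), (3 * ((j : ℝ) + 1) * (3 * ((j + 1 : ℕ) : ℝ) + 1)) := by
    simp only [prod_mul_distrib]
    rw [prod_range_succ (fun j : ℕ => (j : ℝ) + 1), prod_range_succ' (fun j : ℕ => 3 * (j : ℝ) + 1),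
      prod_range_succ]
    push_cast
    ring
  rw [← prod_three_mul_add_one_eq, ← prod_mul_distrib, hA, two_mul n, ← h, ← two_mul, prod_range_succ, prod_range_two_mul, ← prod_mul_distrib,
    mul_comm, stair_two_mul, stair_two_mul_add_one]
  congr 1
  · push_cast
    ring
  refine prod_congr rfl fun l hl => ?_
  obtain ⟨m, rfl⟩ := Nat.exists_eq_add_of_lt (mem_range.1 hl)
  rw [stair_two_mul, stair_two_mul_add_one, show l + m + 1 - 1 - l = m by omega]
  push_cast
  ring

lemma pow_mul_factorial_mul_prod_mul_prod (n : ℕ) :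
    3 ^ n * n.factorial * (∏ j ∈ range n, (3 * (j : ℝ) + 2)) *
      ∏ j ∈ range n, (3 * (j : ℝ) + 1) = (3 * n).factorial := by
  induction n with
  | zero => simp
  | succ n ih =>
    simp only [prod_range_succ, mul_add_one, Nat.factorial_succ, pow_succ]
    push_cast
    rw [← ih]
    ring

lemma symplDim_two_mul_add_two (n : ℕ) :
    symplDim (2 * n + 2) = symplDim (2 * n) *
      (3 ^ (2 * n) * (3 * (3 * n + 1) * (3 * n + 2) * (6 * n + 1).factorial *
        (2 * n + 1).factorial / ((4 * n + 1).factorial * (4 * n + 3).factorial))) := by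
  have h := pow_mul_factorial_mul_prod_mul_prod (2 * n)
  rw [symplDim_succ, symplDim_succ, prod_stair_even, prod_stair_odd, stair_two_mul,
    stair_two_mul_add_one,
    prod_range_succ (fun j : ℕ => 3 * (j : ℝ) + 1), Nat.factorial_succ (6 * n),
    show 6 * n = 3 * (2 * n) by ring, show 2 * (2 * n) + 1 = 4 * n + 1 by ring,
    show 2 * (2 * n + 1) + 1 = 4 * n + 3 by ring]
  push_cast
  rw [← h]
  ring

lemma symplDim_two_mul_add_three (n : ℕ) :
    symplDim (2 * n + 3) = symplDim (2 * n + 1) *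
      (3 ^ (2 * n + 1) * (3 * (3 * n + 2) * (3 * n + 4) * (6 * n + 3).factorial * (6 * n + 5) *
        (2 * n + 2).factorial / ((4 * n + 3).factorial * (4 * n + 5).factorial))) := by
  have h := pow_mul_factorial_mul_prod_mul_prod (2 * n + 1)
  rw [symplDim_succ, symplDim_succ, show 2 * n + 1 + 1 = 2 * (n + 1) by ring, prod_stair_even,
    prod_stair_odd, stair_two_mul, stair_two_mul_add_one, show 2 * (n + 1) = 2 * n + 1 + 1 by ring,
    prod_range_succ (fun j : ℕ => 3 * (j : ℝ) + 2), show 6 * n + 3 = 3 * (2 * n + 1) by ring,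
    show 2 * (2 * n + 1) + 1 = 4 * n + 3 by ring, show 2 * (2 * n + 1 + 1) + 1 = 4 * n + 5 by ring]
  push_cast
  rw [← h]
  ring

lemma gammaN_two_mul_add_two (n : ℕ) :
    gammaN (2 * n + 2) = gammaN (2 * n) * (3 * (3 * n + 1) * (3 * n + 2) * (6 * n + 1).factorial *
        (2 * n + 1).factorial / ((4 * n + 1).factorial * (4 * n + 3).factorial)) := by
  have h₁ : (2 * n + 2) % 2 = 0 := by omega
  have h₂ : (2 * n) % 2 = 0 := by omega
  rw [gammaN, gammaN, if_pos h₁, if_pos h₂, show (2 * n + 2) / 2 = n + 1 by omega,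
    show 2 * n / 2 = n by omega, prod_Icc_succ_top (by omega), pow_succ,
    show 6 * (n + 1) - 2 = 6 * n + 1 + 1 + 1 + 1 by omega,
    show 2 * (n + 1) - 1 = 2 * n + 1 by omega, show 4 * (n + 1) - 2 = 4 * n + 1 + 1 by omega,
    show 4 * (n + 1) - 1 = 4 * n + 3 by omega, Nat.factorial_succ (6 * n + 1 + 1 + 1),
    Nat.factorial_succ (6 * n + 1 + 1), Nat.factorial_succ (6 * n + 1),
    Nat.factorial_succ (4 * n + 1)]
  push_cast
  have h₃ := Nat.cast_ne_zero (R := ℝ).2 (Nat.factorial_ne_zero (4 * n + 1))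
  have h₄ := Nat.cast_ne_zero (R := ℝ).2 (Nat.factorial_ne_zero (4 * n + 3))
  field_simp
  ring

lemma gammaN_two_mul_add_three (n : ℕ) :
    gammaN (2 * n + 3) = gammaN (2 * n + 1) *
      (3 * (3 * n + 2) * (3 * n + 4) * (6 * n + 3).factorial * (6 * n + 5) *
        (2 * n + 2).factorial / ((4 * n + 3).factorial * (4 * n + 5).factorial)) := by
  have h₁ : ¬ (2 * n + 3) % 2 = 0 := by omega
  have h₂ : ¬ (2 * n + 1) % 2 = 0 := by omega
  rw [gammaN, gammaN, if_neg h₁, if_neg h₂, show (2 * n + 3 + 1) / 2 = n + 1 + 1 by omega,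
    show (2 * n + 1 + 1) / 2 = n + 1 by omega, prod_range_succ _ (n + 1),
    show 6 * (n + 1) = 6 * n + 3 + 1 + 1 + 1 by ring,
    show 2 * (n + 1) = 2 * n + 2 by ring, show 4 * (n + 1) = 4 * n + 3 + 1 by ring,
    Nat.factorial_succ (6 * n + 3 + 1 + 1),
    Nat.factorial_succ (6 * n + 3 + 1), Nat.factorial_succ (6 * n + 3),
    Nat.factorial_succ (4 * n + 3)]
  push_cast
  have h₃ := Nat.cast_ne_zero (R := ℝ).2 (Nat.factorial_ne_zero (4 * n + 3))
  have h₄ := Nat.cast_ne_zero (R := ℝ).2 (Nat.factorial_ne_zero (4 * n + 5))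
  field_simp
  ring

lemma nuN_add_two (N : ℕ) : nuN (N + 2) = nuN N + N := by
  obtain ⟨n, rfl | rfl⟩ := Nat.even_or_odd' N
  · rw [nuN, nuN, if_pos (by omega), if_pos (by omega), show (2 * n + 2) / 2 = n + 1 by omega,
      show 2 * n / 2 = n by omega]
    cases n with
    | zero => rfl
    | succ n =>
      simp only [Nat.add_sub_cancel]
      ring
  · rw [nuN, nuN, if_neg (by omega), if_neg (by omega), show (2 * n + 1 + 2) / 2 = n + 1 by omega,
      show (2 * n + 1) / 2 = n by omega]
    ring

lemma symplDim_eq (N : ℕ) : symplDim N = 3 ^ nuN N * gammaN N := by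
  induction N using Nat.twoStepInduction with
  | zero => simp [symplDim, nuN, gammaN]
  | one => simp [symplDim, nuN, gammaN, muE, deltaE]
  | more N ih _ =>
    rw [nuN_add_two, pow_add]
    obtain ⟨n, rfl | rfl⟩ := Nat.even_or_odd' N
    · rw [symplDim_two_mul_add_two, gammaN_two_mul_add_two, ih]
      ring
    · rw [symplDim_two_mul_add_three, gammaN_two_mul_add_three, ih]
      ring

/-- **Corollary 3.6.** `χ_N(1, …, 1) = 3^{ν_N} γ_N`. -/
theorem sympl_char_all_ones (N : ℕ) (hN : 1 ≤ N)
    (X : (Fin N → ℂ) → ℂ) (hX : IsSymplecticExt N X) :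
    X (fun _ => 1) = (3:ℂ)^(nuN N) * ((gammaN N : ℝ) : ℂ) := by
  rw [hX.apply_one, symplDim_eq]
  push_cast
  rfl


end
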